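/- Let ν = wμ be a probability measure with strictly positive density w. If (x_1,…,x_n) ∼ γ_m ⊗ ν^{⊗(n−m)} (i.e. the first m points from the projection DPP γ_m and the remaining n−m points i.i.d. from ν, independently) and σ is an independent uniformly random permutation of {1,…,n}, then (x_{σ(1)},…,x_{σ(n)}) ∼ γ_n^ν. Consequently all one-dimensional marginals of γ_n^ν equal ν̃ = w̃μ with w̃ = (m/n)·w_m + ((n−m)/n)·w. Moreover, if w ≥ α·w_m μ-a.e. for some α > 0, then (1 − m/n)·w ≤ w̃ ≤ (1 + (α^{-1}−1)·m/n)·w μ-almost everywhere. -/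

import Mathlib

open MeasureTheory ProbabilityTheory Matrix Finset
open scoped ENNReal NNReal BigOperators RealInnerProductSpace

noncomputable section

namespace WLSDPP

variable {𝓧 : Type*} [MeasurableSpace 𝓧]

/-- Smallest eigenvalue of a real symmetric matrix, via the Rayleigh quotient. -/
def lambdaMin {m : ℕ} (A : Matrix (Fin m) (Fin m) ℝ) : ℝ :=
  ⨅ v : {v : Fin m → ℝ // ∑ i, v i ^ 2 = 1}, (v : Fin m → ℝ) ⬝ᵥ A.mulVec v

/-- The feature vector `𝛗(x) = (φ₁(x),…,φ_m(x))ᵀ`. -/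
def feat {m : ℕ} (φ : Fin m → 𝓧 → ℝ) (x : 𝓧) : Fin m → ℝ := fun j => φ j x

/-- Empirical Gram matrix `G^w(x) = (1/n) ∑ᵢ w(xᵢ)⁻¹ 𝛗(xᵢ)𝛗(xᵢ)ᵀ`. -/
def gram {m n : ℕ} (φ : Fin m → 𝓧 → ℝ) (w : 𝓧 → ℝ) (x : Fin n → 𝓧) :
    Matrix (Fin m) (Fin m) ℝ :=
  (n : ℝ)⁻¹ • ∑ i, (w (x i))⁻¹ • vecMulVec (feat φ (x i)) (feat φ (x i))

/-- Empirical seminorm squared `‖f‖ₙ² = (1/n) ∑ᵢ w(xᵢ)⁻¹ f(xᵢ)²`. -/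
def empSq {n : ℕ} (w : 𝓧 → ℝ) (f : 𝓧 → ℝ) (x : Fin n → 𝓧) : ℝ :=
  (n : ℝ)⁻¹ * ∑ i, (w (x i))⁻¹ * f (x i) ^ 2

/-- Squared L²(μ) norm. -/
def l2Sq (μ : Measure 𝓧) (f : 𝓧 → ℝ) : ℝ := ∫ y, f y ^ 2 ∂μ

/-- L²(μ) norm. -/
def l2 (μ : Measure 𝓧) (f : 𝓧 → ℝ) : ℝ := Real.sqrt (l2Sq μ f)

/-- The element of `V_m` with coefficient vector `a`. -/
def lin {m : ℕ} (φ : Fin m → 𝓧 → ℝ) (a : Fin m → ℝ) : 𝓧 → ℝ := fun y => ∑ j, a j * φ j y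

/-- The L²(μ)-orthogonal projection onto `V_m` (for `φ` an orthonormal basis of `V_m`). -/
def projV {m : ℕ} (μ : Measure 𝓧) (φ : Fin m → 𝓧 → ℝ) (f : 𝓧 → ℝ) : 𝓧 → ℝ :=
  lin φ (fun j => ∫ y, φ j y * f y ∂μ)

/-- The right-hand side vector `b = (1/n) ∑ᵢ w(xᵢ)⁻¹ f(xᵢ) 𝛗(xᵢ)`. -/
def bVec {m n : ℕ} (φ : Fin m → 𝓧 → ℝ) (w : 𝓧 → ℝ) (f : 𝓧 → ℝ) (x : Fin n → 𝓧) :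
    Fin m → ℝ :=
  (n : ℝ)⁻¹ • ∑ i, ((w (x i))⁻¹ * f (x i)) • feat φ (x i)

/-- The weighted least-squares projection `P̂_{V_m} f = 𝛗(·)ᵀ (G^w)⁻¹ b`. -/
def lsProj {m n : ℕ} (φ : Fin m → 𝓧 → ℝ) (w : 𝓧 → ℝ) (f : 𝓧 → ℝ) (x : Fin n → 𝓧) :
    𝓧 → ℝ :=
  lin φ ((gram φ w x)⁻¹ *ᵥ bVec φ w f x)

/-- The measure with density `w` with respect to `μ`. -/
def dens (μ : Measure 𝓧) (w : 𝓧 → ℝ) : Measure 𝓧 :=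
  μ.withDensity fun a => ENNReal.ofReal (w a)

/-- The inverse Christoffel density `w_m(x) = (1/m) ‖𝛗(x)‖₂²`. -/
def wChr {m : ℕ} (φ : Fin m → 𝓧 → ℝ) : 𝓧 → ℝ := fun x => (m : ℝ)⁻¹ * ∑ i, φ i x ^ 2

/-- The feature matrix `Φ(x)` with `i`-th row `𝛗(xᵢ)ᵀ`. -/
def featM {m n : ℕ} (φ : Fin m → 𝓧 → ℝ) (x : Fin n → 𝓧) : Matrix (Fin n) (Fin m) ℝ :=
  Matrix.of fun i j => φ j (x i)

/-- The weighted feature matrix `Φ^w(x)` with `i`-th row `w(xᵢ)^{-1/2} 𝛗(xᵢ)ᵀ`. -/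
def featW {m n : ℕ} (φ : Fin m → 𝓧 → ℝ) (w : 𝓧 → ℝ) (x : Fin n → 𝓧) :
    Matrix (Fin n) (Fin m) ℝ :=
  Matrix.of fun i j => (Real.sqrt (w (x i)))⁻¹ * φ j (x i)

/-- The projection DPP `γ_m`, with density `(1/m!) det(Φ(x)ᵀΦ(x))` w.r.t. `μ^⊗m`. -/
def dpp {m : ℕ} (μ : Measure 𝓧) (φ : Fin m → 𝓧 → ℝ) : Measure (Fin m → 𝓧) :=
  (Measure.pi fun _ : Fin m => μ).withDensity fun x =>
    ENNReal.ofReal ((m.factorial : ℝ)⁻¹ * ((featM φ x)ᵀ * featM φ x).det)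

/-- The generalized volume sampling distribution `γ_n^ν`, `ν = wμ`, with density
`n^m ((n−m)!/n!) det(G^w(x))` with respect to `ν^⊗n`. -/
def vs {m : ℕ} (μ : Measure 𝓧) (φ : Fin m → 𝓧 → ℝ) (w : 𝓧 → ℝ) (n : ℕ) :
    Measure (Fin n → 𝓧) :=
  (Measure.pi fun _ : Fin n => dens μ w).withDensity fun x =>
    ENNReal.ofReal ((n : ℝ) ^ m * ((n - m).factorial : ℝ) / (n.factorial : ℝ) *
      (gram φ w x).det)

/-- `c_δ = δ + (1−δ) log(1−δ)`. -/
def cDelta (δ : ℝ) : ℝ := δ + (1 - δ) * Real.log (1 - δ)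

/-- `φ₁, …, φ_m` is an orthonormal system in `L²_μ`. -/
def IsONB {m : ℕ} (μ : Measure 𝓧) (φ : Fin m → 𝓧 → ℝ) : Prop :=
  ∀ i j, ∫ y, φ i y * φ j y ∂μ = if i = j then (1 : ℝ) else 0

end WLSDPP

namespace WLSDPP

section Determinants

theorem det_sq_eq_sum_perm {m : ℕ} (B : Matrix (Fin m) (Fin m) ℝ) :
    B.det ^ 2 = ∑ σ : Equiv.Perm (Fin m), ∑ τ : Equiv.Perm (Fin m),
      ((Equiv.Perm.sign σ : ℤ) : ℝ) * ((Equiv.Perm.sign τ : ℤ) : ℝ) *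
        ∏ i, (B i (σ i) * B i (τ i)) := by
  rw [sq, ← det_transpose B, det_apply', Finset.sum_mul_sum]
  refine Finset.sum_congr rfl fun σ _ => Finset.sum_congr rfl fun τ _ => ?_
  simp only [transpose_apply, Finset.prod_mul_distrib]
  ring

theorem sum_perm_sum_perm_sign_mul_prod {m : ℕ} (C : Matrix (Fin m) (Fin m) ℝ) :
    ∑ σ : Equiv.Perm (Fin m), ∑ τ : Equiv.Perm (Fin m),
      ((Equiv.Perm.sign σ : ℤ) : ℝ) * ((Equiv.Perm.sign τ : ℤ) : ℝ) *
        ∏ i, C (σ i) (τ i) = (m.factorial : ℝ) * C.det := by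
  have h : ∀ σ : Equiv.Perm (Fin m), ∑ τ : Equiv.Perm (Fin m),
      ((Equiv.Perm.sign σ : ℤ) : ℝ) * ((Equiv.Perm.sign τ : ℤ) : ℝ) *
        ∏ i, C (σ i) (τ i) = C.det := by
    intro σ
    have h1 := det_permute σ C
    rw [← det_transpose, det_apply'] at h1
    simp only [transpose_apply, submatrix_apply, id] at h1
    simp_rw [mul_assoc]
    rw [← Finset.mul_sum, h1, ← mul_assoc]
    norm_cast
    simp
  simp [h, Fintype.card_perm]

/-- Finite form of Andréief's identity. -/
theorem sum_det_submatrix_sq {m : ℕ} {ι : Type*} [Fintype ι] (A : Matrix ι (Fin m) ℝ) :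
    ∑ e : Fin m → ι, (A.submatrix e id).det ^ 2 = (m.factorial : ℝ) * (Aᵀ * A).det := by
  classical
  simp_rw [det_sq_eq_sum_perm]
  rw [Finset.sum_comm, ← sum_perm_sum_perm_sign_mul_prod]
  refine Finset.sum_congr rfl fun σ _ => ?_
  rw [Finset.sum_comm]
  refine Finset.sum_congr rfl fun τ _ => ?_
  rw [← Finset.mul_sum]
  simp [Matrix.mul_apply, Finset.prod_univ_sum, Fintype.piFinset_univ]

theorem sum_perm_comp_castAdd {m q : ℕ} (F : (Fin m → Fin (m + q)) → ℝ) :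
    ∑ σ : Equiv.Perm (Fin (m + q)), F (fun i => σ (Fin.castAdd q i))
      = (q.factorial : ℝ) * ∑ e : Fin m ↪ Fin (m + q), F e := by
  classical
  let E : Equiv.Perm (Fin (m + q)) ≃
      Σ f : Fin m ↪ Fin (m + q), Fin q ↪ ↥(Set.range f)ᶜ :=
    ((Equiv.embeddingEquivOfFinite (Fin (m + q))).symm.trans
      (Equiv.embeddingCongr finSumFinEquiv.symm (Equiv.refl _))).trans
      Equiv.sumEmbeddingEquivSigmaEmbeddingRestricted
  have hE : ∀ σ : Equiv.Perm (Fin (m + q)),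
      F (fun i => σ (Fin.castAdd q i)) = F (E σ).1 := by
    intro σ
    rfl
  rw [Fintype.sum_congr _ _ hE, E.sum_comp (fun p => F p.1), Fintype.sum_sigma, Finset.mul_sum]
  refine Finset.sum_congr rfl fun f _ => ?_
  have hc : Fintype.card (Fin q ↪ ↥(Set.range f)ᶜ) = q.factorial := by
    rw [Fintype.card_embedding_eq, Fintype.card_compl_set, Set.card_range_of_injective f.injective]
    simp [Nat.descFactorial_self]
  simp [hc]

theorem sum_perm_det_submatrix_sq {m q : ℕ} (A : Matrix (Fin (m + q)) (Fin m) ℝ) :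
    ∑ σ : Equiv.Perm (Fin (m + q)), (A.submatrix (fun i => σ (Fin.castAdd q i)) id).det ^ 2
      = (q.factorial : ℝ) * ((m.factorial : ℝ) * (Aᵀ * A).det) := by
  classical
  rw [sum_perm_comp_castAdd (fun e => (A.submatrix e id).det ^ 2), ← sum_det_submatrix_sq]
  congr 1
  refine Fintype.sum_of_injective (fun e : Fin m ↪ Fin (m + q) => (e : Fin m → Fin (m + q)))
    DFunLike.coe_injective _ _ (fun e he => ?_) fun _ => rfl
  have hinj : ¬ Function.Injective e := fun h => he ⟨⟨e, h⟩, rfl⟩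
  simp only [Function.Injective, not_forall] at hinj
  obtain ⟨a, b, hab, hne⟩ := hinj
  rw [det_zero_of_row_eq hne (by ext k; simp [hab])]
  simp

/-- Averaging a function over the images of a point under all permutations. -/
theorem card_nsmul_sum_perm_apply {ι M : Type*} [Fintype ι] [DecidableEq ι] [AddCommMonoid M]
    (G : ι → M) (i : ι) :
    Fintype.card ι • ∑ σ : Equiv.Perm ι, G (σ i)
      = (Fintype.card ι).factorial • ∑ k, G k := by
  have h : ∀ j, ∑ σ : Equiv.Perm ι, G (σ j) = ∑ σ : Equiv.Perm ι, G (σ i) := by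
    intro j
    rw [← Equiv.sum_comp (Equiv.mulRight (Equiv.swap i j))]
    simp
  calc Fintype.card ι • ∑ σ : Equiv.Perm ι, G (σ i)
      = ∑ j, ∑ σ : Equiv.Perm ι, G (σ j) := by simp [h]
    _ = ∑ σ : Equiv.Perm ι, ∑ j, G (σ j) := Finset.sum_comm
    _ = _ := by simp [Equiv.sum_comp, Fintype.card_perm]

end Determinants

end WLSDPP

namespace WLSDPP

section Measures

theorem pi_withDensity {α ι : Type*} [MeasurableSpace α] [Fintype ι] (μ : Measure α)
    [IsProbabilityMeasure μ] {f : α → ℝ≥0∞} (hf : Measurable f)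
    [SigmaFinite (μ.withDensity f)] :
    (Measure.pi fun _ : ι => μ.withDensity f)
      = (Measure.pi fun _ : ι => μ).withDensity fun x => ∏ i, f (x i) := by
  refine Measure.pi_eq fun s hs => ?_
  have hind : iIndepFun (fun i (x : ι → α) => (s i).indicator f (x i))
      (Measure.pi fun _ : ι => μ) :=
    iIndepFun_pi (X := fun i => (s i).indicator f) fun i => (hf.indicator (hs i)).aemeasurable
  have hpt : ∀ x : ι → α, (Set.univ.pi s).indicator (fun x => ∏ i, f (x i)) x
      = ∏ i, (s i).indicator f (x i) := by
    intro x
    by_cases hx : x ∈ Set.univ.pi s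
    · rw [Set.indicator_of_mem hx]
      exact Finset.prod_congr rfl fun i _ => (Set.indicator_of_mem (hx i trivial) f).symm
    · rw [Set.indicator_of_notMem hx]
      simp only [Set.mem_pi, not_forall] at hx
      obtain ⟨i, _, hi⟩ := hx
      exact (Finset.prod_eq_zero (Finset.mem_univ i) (Set.indicator_of_notMem hi f)).symm
  rw [withDensity_apply _ (MeasurableSet.univ_pi hs),
    ← lintegral_indicator (MeasurableSet.univ_pi hs), lintegral_congr hpt,
    lintegral_prod_eq_prod_lintegral_of_indepFun _ _ hind]
  · refine Finset.prod_congr rfl fun i _ => ?_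
    rw [withDensity_apply _ (hs i), ← lintegral_indicator (hs i)]
    exact (measurePreserving_eval (fun _ : ι => μ) i).lintegral_comp (hf.indicator (hs i))
  · exact fun i => (hf.indicator (hs i)).comp (measurable_pi_apply i)

theorem map_withDensity_comp {α β : Type*} [MeasurableSpace α] [MeasurableSpace β]
    {μ : Measure α} {ν : Measure β} {T : α → β} (hT : MeasurePreserving T μ ν)
    {h : β → ℝ≥0∞} (hh : Measurable h) :
    (μ.withDensity fun x => h (T x)).map T = ν.withDensity h := by
  ext s hs
  rw [Measure.map_apply hT.measurable hs, withDensity_apply _ (hT.measurable hs),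
    withDensity_apply _ hs, hT.setLIntegral_comp_preimage hs hh]

theorem sum_withDensity {α ι : Type*} [MeasurableSpace α] (μ : Measure α) (s : Finset ι)
    {f : ι → α → ℝ≥0∞} (hf : ∀ i, Measurable (f i)) :
    ∑ i ∈ s, μ.withDensity (f i) = μ.withDensity fun x => ∑ i ∈ s, f i x := by
  ext t ht
  simp only [Measure.finsetSum_apply, withDensity_apply _ ht]
  rw [lintegral_finsetSum _ fun i _ => hf i]

theorem measurePreserving_append_perm {α : Type*} [MeasurableSpace α] {m q : ℕ}
    (ν : Measure α) [SigmaFinite ν] (σ : Equiv.Perm (Fin (m + q))) :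
    MeasurePreserving
      (fun (p : (Fin m → α) × (Fin q → α)) (i : Fin (m + q)) => Fin.append p.1 p.2 (σ i))
      ((Measure.pi fun _ => ν).prod (Measure.pi fun _ => ν)) (Measure.pi fun _ => ν) := by
  have hT : Measurable (fun (p : (Fin m → α) × (Fin q → α)) (i : Fin (m + q)) =>
      Fin.append p.1 p.2 (σ i)) := by
    refine measurable_pi_lambda _ fun i => ?_
    induction σ i using Fin.addCases with
    | left j => simp only [Fin.append_left]; fun_prop
    | right j => simp only [Fin.append_right]; fun_prop
  refine ⟨hT, (Measure.pi_eq fun s hs => ?_).symm⟩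
  rw [Measure.map_apply hT (MeasurableSet.univ_pi hs)]
  have hpre : (fun (p : (Fin m → α) × (Fin q → α)) (i : Fin (m + q)) =>
      Fin.append p.1 p.2 (σ i)) ⁻¹' (Set.univ.pi s)
      = (Set.univ.pi fun j => s (σ.symm (Fin.castAdd q j))) ×ˢ
        (Set.univ.pi fun j => s (σ.symm (Fin.natAdd m j))) := by
    ext p
    simp only [Set.mem_preimage, Set.mem_pi, Set.mem_univ, true_imp_iff, Set.mem_prod]
    rw [← σ.symm.forall_congr_right]
    simp [Fin.forall_fin_add]
  rw [hpre, Measure.prod_prod, Measure.pi_pi, Measure.pi_pi, ← σ.symm.prod_comp,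
    Fin.prod_univ_add]

end Measures

end WLSDPP

namespace WLSDPP

section FeatureMatrices

variable {𝓨 : Type*} {m n : ℕ} {φ : Fin m → 𝓨 → ℝ} {w : 𝓨 → ℝ}

theorem det_transpose_mul_featM (φ : Fin m → 𝓨 → ℝ) (x : Fin m → 𝓨) :
    ((featM φ x)ᵀ * featM φ x).det = (featM φ x).det ^ 2 := by
  rw [det_mul, det_transpose, sq]

theorem det_featW_sq (hw : ∀ y, 0 ≤ w y) (x : Fin m → 𝓨) :
    (featW φ w x).det ^ 2 = (∏ i, (w (x i))⁻¹) * (featM φ x).det ^ 2 := by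
  have h : featW φ w x = Matrix.of fun i j => (Real.sqrt (w (x i)))⁻¹ * featM φ x i j := rfl
  rw [h, det_mul_column, mul_pow, ← Finset.prod_pow]
  simp [inv_pow, Real.sq_sqrt (hw _)]

theorem gram_eq_smul_transpose_mul (hw : ∀ y, 0 ≤ w y) (x : Fin n → 𝓨) :
    gram φ w x = (n : ℝ)⁻¹ • ((featW φ w x)ᵀ * featW φ w x) := by
  unfold gram
  congr 1
  ext i j
  simp only [Matrix.sum_apply, Matrix.smul_apply, vecMulVec_apply, feat, smul_eq_mul,
    Matrix.mul_apply, transpose_apply, featW, of_apply]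
  refine Finset.sum_congr rfl fun k _ => ?_
  have h : (w (x k))⁻¹ = (Real.sqrt (w (x k)))⁻¹ * (Real.sqrt (w (x k)))⁻¹ := by
    rw [← mul_inv, Real.mul_self_sqrt (hw _)]
  rw [h]
  ring

theorem pow_mul_det_gram (hn : 0 < n) (hw : ∀ y, 0 ≤ w y) (x : Fin n → 𝓨) :
    (n : ℝ) ^ m * (gram φ w x).det = ((featW φ w x)ᵀ * featW φ w x).det := by
  have hn' : (n : ℝ) ≠ 0 := by positivity
  rw [gram_eq_smul_transpose_mul hw, det_smul, Fintype.card_fin, ← mul_assoc, ← mul_pow,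
    mul_inv_cancel₀ hn', one_pow, one_mul]

theorem wChr_nonneg (φ : Fin m → 𝓨 → ℝ) (y : 𝓨) : 0 ≤ wChr φ y := by
  unfold wChr
  positivity

end FeatureMatrices

section Densities

variable {𝓨 : Type*} [MeasurableSpace 𝓨] {m q : ℕ} {φ : Fin m → 𝓨 → ℝ} {w : 𝓨 → ℝ}
  {μ : Measure 𝓨}

theorem measurable_det_featW (hφ : ∀ j, Measurable (φ j)) (hw : Measurable w) :
    Measurable fun x : Fin m → 𝓨 => (featW φ w x).det := by
  simp only [det_apply', featW, of_apply]
  fun_prop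

theorem measurable_det_featM (hφ : ∀ j, Measurable (φ j)) :
    Measurable fun x : Fin m → 𝓨 => (featM φ x).det := by
  simp only [det_apply', featM, of_apply]
  fun_prop

theorem isProbabilityMeasure_dens (hw : ∀ y, 0 ≤ w y) (hwint : ∫ y, w y ∂μ = 1) :
    IsProbabilityMeasure (dens μ w) := by
  refine ⟨?_⟩
  have hi : Integrable w μ := by
    by_contra h
    rw [integral_undef h] at hwint
    exact zero_ne_one hwint
  rw [dens, withDensity_apply _ MeasurableSet.univ, Measure.restrict_univ,
    ← ofReal_integral_eq_lintegral_ofReal hi (Filter.Eventually.of_forall hw), hwint,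
    ENNReal.ofReal_one]

theorem dpp_eq_withDensity_pi_dens [IsProbabilityMeasure μ] (hφ : ∀ j, Measurable (φ j))
    (hwpos : ∀ y, 0 < w y) (hw : Measurable w) [SigmaFinite (dens μ w)] :
    dpp μ φ = (Measure.pi fun _ : Fin m => dens μ w).withDensity fun x =>
      ENNReal.ofReal ((m.factorial : ℝ)⁻¹ * (featW φ w x).det ^ 2) := by
  have hofw : Measurable fun y => ENNReal.ofReal (w y) := hw.ennreal_ofReal
  have : SigmaFinite (μ.withDensity fun y => ENNReal.ofReal (w y)) :=
    inferInstanceAs (SigmaFinite (dens μ w))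
  have hd := measurable_det_featW hφ hw
  unfold dens
  rw [pi_withDensity μ hofw, ← withDensity_mul _ (by fun_prop) (by fun_prop)]
  unfold dpp
  congr 1
  ext x
  have hp : 0 ≤ ∏ i, w (x i) := Finset.prod_nonneg fun i _ => (hwpos _).le
  rw [Pi.mul_apply, ← ENNReal.ofReal_prod_of_nonneg fun i _ => (hwpos _).le,
    ← ENNReal.ofReal_mul hp, det_featW_sq fun y => (hwpos y).le, det_transpose_mul_featM]
  have hc : (∏ i, w (x i)) * ∏ i, (w (x i))⁻¹ = 1 := by
    rw [← Finset.prod_mul_distrib]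
    exact Finset.prod_eq_one fun i _ => mul_inv_cancel₀ (hwpos _).ne'
  congr 1
  linear_combination (-(m.factorial : ℝ)⁻¹ * (featM φ x).det ^ 2) * hc

theorem average_map_append_perm_eq_vs [IsProbabilityMeasure μ] (hm : 0 < m)
    (hφ : ∀ j, Measurable (φ j)) (hwpos : ∀ y, 0 < w y) (hw : Measurable w) [SigmaFinite (dens μ w)] :
    ((Fintype.card (Equiv.Perm (Fin (m + q))) : ℝ≥0∞))⁻¹ •
        (∑ σ : Equiv.Perm (Fin (m + q)),
          (((dpp μ φ).prod (Measure.pi fun _ : Fin q => dens μ w)).map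
            (fun p => fun i : Fin (m + q) => Fin.append p.1 p.2 (σ i))))
      = vs μ φ w (m + q) := by
  have hd := measurable_det_featW hφ hw
  have hg : Measurable fun x : Fin m → 𝓨 =>
      ENNReal.ofReal ((m.factorial : ℝ)⁻¹ * (featW φ w x).det ^ 2) := by fun_prop
  have hperm : ∀ σ : Equiv.Perm (Fin (m + q)), Measurable fun x : Fin (m + q) → 𝓨 =>
      ENNReal.ofReal ((m.factorial : ℝ)⁻¹ *
        (featW φ w fun j => x (σ.symm (Fin.castAdd q j))).det ^ 2) := fun σ =>
    hg.comp (measurable_pi_lambda _ fun j => measurable_pi_apply (σ.symm (Fin.castAdd q j)))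
  have hterm : ∀ σ : Equiv.Perm (Fin (m + q)),
      ((dpp μ φ).prod (Measure.pi fun _ : Fin q => dens μ w)).map
          (fun p => fun i : Fin (m + q) => Fin.append p.1 p.2 (σ i))
        = (Measure.pi fun _ => dens μ w).withDensity fun x =>
          ENNReal.ofReal ((m.factorial : ℝ)⁻¹ *
            (featW φ w fun j => x (σ.symm (Fin.castAdd q j))).det ^ 2) := by
    intro σ
    rw [dpp_eq_withDensity_pi_dens hφ hwpos hw, prod_withDensity_left hg,
      ← map_withDensity_comp (measurePreserving_append_perm (dens μ w) σ) (hperm σ)]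
    simp
  rw [Finset.sum_congr rfl fun σ _ => hterm σ, sum_withDensity _ _ hperm,
    ← withDensity_smul _ (Finset.measurable_fun_sum _ fun σ _ => hperm σ)]
  unfold vs
  congr 1
  ext x
  have hsum : ∑ σ : Equiv.Perm (Fin (m + q)),
      (featW φ w fun j => x (σ.symm (Fin.castAdd q j))).det ^ 2
      = (q.factorial : ℝ) * ((m.factorial : ℝ) * ((featW φ w x)ᵀ * featW φ w x).det) := by
    rw [← sum_perm_det_submatrix_sq]
    exact Equiv.sum_comp (Equiv.inv (Equiv.Perm (Fin (m + q)))) fun σ =>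
      ((featW φ w x).submatrix (fun i => σ (Fin.castAdd q i)) id).det ^ 2
  have hN : (0 : ℝ) < (m + q).factorial := by positivity
  have hM : (0 : ℝ) < m.factorial := by positivity
  rw [Pi.smul_apply, smul_eq_mul, ← ENNReal.ofReal_sum_of_nonneg fun σ _ => by positivity,
    ← Finset.mul_sum, hsum, ← pow_mul_det_gram (by omega) fun y => (hwpos y).le,
    Fintype.card_perm, Fintype.card_fin, ← ENNReal.ofReal_natCast,
    ← ENNReal.ofReal_inv_of_pos hN, ← ENNReal.ofReal_mul (by positivity),
    Nat.add_sub_cancel_left]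
  congr 1
  field_simp

end Densities

section Marginals

variable {𝓨 : Type*} [MeasurableSpace 𝓨] {m q : ℕ} {φ : Fin m → 𝓨 → ℝ}
  {μ : Measure 𝓨}

theorem IsONB.integrable_mul (horth : IsONB μ φ) (hφ : ∀ j, Measurable (φ j)) (i j : Fin m) :
    Integrable (fun y => φ i y * φ j y) μ := by
  have h : ∀ i, MemLp (φ i) 2 μ := by
    intro i
    rw [memLp_two_iff_integrable_sq (hφ i).aestronglyMeasurable]
    by_contra hn
    have h1 := horth i i
    simp only [← sq] at h1
    rw [integral_undef hn] at h1
    simp at h1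
  exact (h i).integrable_mul (h j)

theorem IsONB.integral_wChr (horth : IsONB μ φ) (hφ : ∀ j, Measurable (φ j)) (hm : 0 < m) :
    ∫ y, wChr φ y ∂μ = 1 := by
  have hm' : (m : ℝ) ≠ 0 := by positivity
  simp only [wChr, sq]
  rw [integral_const_mul, integral_finsetSum _ fun i _ => horth.integrable_mul hφ i i,
    Finset.sum_congr rfl fun i _ => horth i i]
  simp [hm']

theorem measurable_wChr (hφ : ∀ j, Measurable (φ j)) : Measurable (wChr φ) := by
  unfold wChr
  fun_prop

theorem eq_of_forall_ne_apply_eq {ι : Type*} {σ τ : Equiv.Perm ι} (k : ι)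
    (h : ∀ i, i ≠ k → σ i = τ i) : σ = τ := by
  ext i
  by_cases hi : i = k
  · subst hi
    by_contra hne
    have h1 : σ.symm (τ i) ≠ i := fun hh => hne (by rw [Equiv.symm_apply_eq] at hh; exact hh.symm)
    have h2 := h _ h1
    rw [Equiv.apply_symm_apply] at h2
    exact h1 (τ.injective h2.symm)
  · exact h i hi

theorem prod_integral_mul_ite_indicator [IsProbabilityMeasure μ] (horth : IsONB μ φ)
    (k : Fin m) (s : Set 𝓨) (σ τ : Equiv.Perm (Fin m)) :
    ∏ i, ∫ y, φ (σ i) y * φ (τ i) y * (if i = k then s.indicator 1 y else 1) ∂μ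
      = if σ = τ then ∫ y, φ (σ k) y * φ (σ k) y * s.indicator 1 y ∂μ else 0 := by
  split_ifs with h
  · subst h
    rw [Finset.prod_eq_single_of_mem k (Finset.mem_univ k)]
    · simp
    · intro i _ hi
      simpa [hi] using horth (σ i) (σ i)
  · have : ∃ i, i ≠ k ∧ σ i ≠ τ i := by
      by_contra! hc
      exact h (eq_of_forall_ne_apply_eq k hc)
    obtain ⟨i, hi, hne⟩ := this
    refine Finset.prod_eq_zero (Finset.mem_univ i) ?_
    simpa [hi, hne] using horth (σ i) (τ i)

theorem dpp_map_eval [IsProbabilityMeasure μ] (horth : IsONB μ φ) (hφ : ∀ j, Measurable (φ j))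
    (k : Fin m) :
    (dpp μ φ).map (fun x => x k) = dens μ (wChr φ) := by
  have hm : 0 < m := k.pos
  have hm' : (m : ℝ) ≠ 0 := by positivity
  have hmulInt := horth.integrable_mul hφ
  ext s hs
  let h : Equiv.Perm (Fin m) → Equiv.Perm (Fin m) → Fin m → 𝓨 → ℝ := fun σ τ i y =>
    φ (σ i) y * φ (τ i) y * (if i = k then s.indicator 1 y else 1)
  have hs' : ∀ i j, Integrable (fun y => φ i y * φ j y * s.indicator 1 y) μ := by
    intro i j
    have := (hmulInt i j).indicator hs
    refine this.congr (Filter.Eventually.of_forall fun y => ?_)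
    by_cases hy : y ∈ s <;> simp [hy]
  have hh : ∀ σ τ i, Integrable (h σ τ i) μ := by
    intro σ τ i
    by_cases hi : i = k
    · simpa [h, hi] using hs' (σ k) (τ k)
    · simpa [h, hi] using hmulInt (σ i) (τ i)
  have hprod : ∀ σ τ, Integrable (fun x : Fin m → 𝓨 =>
      ((Equiv.Perm.sign σ : ℤ) : ℝ) * ((Equiv.Perm.sign τ : ℤ) : ℝ) * ∏ i, h σ τ i (x i))
      (Measure.pi fun _ : Fin m => μ) := fun σ τ =>
    (Integrable.fintype_prod (μ := fun _ : Fin m => μ) (hh σ τ)).const_mul _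
  have hexp : ∀ x : Fin m → 𝓨,
      (featM φ x).det ^ 2 * s.indicator 1 (x k) = ∑ σ : Equiv.Perm (Fin m),
        ∑ τ : Equiv.Perm (Fin m),
          ((Equiv.Perm.sign σ : ℤ) : ℝ) * ((Equiv.Perm.sign τ : ℤ) : ℝ) *
            ∏ i, h σ τ i (x i) := by
    intro x
    rw [det_sq_eq_sum_perm, Finset.sum_mul]
    refine Finset.sum_congr rfl fun σ _ => ?_
    rw [Finset.sum_mul]
    refine Finset.sum_congr rfl fun τ _ => ?_
    simp only [h, featM, of_apply, Finset.prod_mul_distrib (g := fun i => ite _ _ _),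
      Finset.prod_ite_eq', Finset.mem_univ, if_true]
    ring
  have hcalc : ∫ x : Fin m → 𝓨, (m.factorial : ℝ)⁻¹ *
      ((featM φ x).det ^ 2 * s.indicator 1 (x k)) ∂(Measure.pi fun _ : Fin m => μ)
      = ∫ y in s, wChr φ y ∂μ := by
    have hJ : ∀ σ τ, ∫ x : Fin m → 𝓨, ∏ i, h σ τ i (x i) ∂(Measure.pi fun _ : Fin m => μ)
        = if σ = τ then ∫ y, φ (σ k) y * φ (σ k) y * s.indicator 1 y ∂μ else 0 := by
      intro σ τ
      rw [integral_fintype_prod_eq_prod (h σ τ), ← prod_integral_mul_ite_indicator horth]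
    have hsgn : ∀ σ : Equiv.Perm (Fin m),
        ((Equiv.Perm.sign σ : ℤ) : ℝ) * ((Equiv.Perm.sign σ : ℤ) : ℝ) = 1 := by
      intro σ
      norm_cast
      simp
    rw [integral_const_mul]
    simp_rw [hexp]
    rw [integral_finsetSum _ fun σ _ => integrable_finsetSum _ fun τ _ => hprod σ τ]
    simp_rw [integral_finsetSum _ fun τ _ => hprod _ τ, integral_const_mul, hJ, mul_ite, mul_zero,
      Finset.sum_ite_eq, Finset.mem_univ, if_true, hsgn, one_mul]
    have hperm := card_nsmul_sum_perm_apply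
      (fun j => ∫ y, φ j y * φ j y * s.indicator 1 y ∂μ) k
    simp only [Fintype.card_fin, nsmul_eq_mul] at hperm
    have hR : ∫ y in s, wChr φ y ∂μ
        = (m : ℝ)⁻¹ * ∑ j, ∫ y, φ j y * φ j y * s.indicator 1 y ∂μ := by
      simp only [wChr, sq]
      rw [integral_const_mul, integral_finsetSum _ fun j _ => (hmulInt j j).integrableOn]
      congr 1
      refine Finset.sum_congr rfl fun j _ => ?_
      rw [← integral_indicator hs]
      refine integral_congr_ae (Filter.Eventually.of_forall fun y => ?_)
      by_cases hy : y ∈ s <;> simp [hy]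
    rw [hR]
    have hf : (m.factorial : ℝ) ≠ 0 := by positivity
    rw [inv_mul_eq_div, inv_mul_eq_div, div_eq_div_iff hf hm']
    linear_combination hperm
  have hintL : Integrable (fun x : Fin m → 𝓨 => (m.factorial : ℝ)⁻¹ *
      ((featM φ x).det ^ 2 * s.indicator 1 (x k))) (Measure.pi fun _ : Fin m => μ) := by
    simp_rw [hexp]
    exact (integrable_finsetSum _ fun σ _ => integrable_finsetSum _ fun τ _ =>
      hprod σ τ).const_mul _
  have hintR : Integrable (wChr φ) μ := by
    unfold wChr
    simp only [sq]
    exact (integrable_finsetSum _ fun j _ => hmulInt j j).const_mul _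
  have hpre : MeasurableSet ((fun x : Fin m → 𝓨 => x k) ⁻¹' s) := measurable_pi_apply k hs
  rw [Measure.map_apply (measurable_pi_apply k) hs, dpp, dens, withDensity_apply _ hpre,
    withDensity_apply _ hs, ← ofReal_integral_eq_lintegral_ofReal hintR.integrableOn
      (Filter.Eventually.of_forall (wChr_nonneg φ)), ← hcalc,
    ofReal_integral_eq_lintegral_ofReal hintL (Filter.Eventually.of_forall fun x => ?_),
    ← lintegral_indicator hpre]
  · refine lintegral_congr fun x => ?_
    simp only [det_transpose_mul_featM]
    by_cases hx : x k ∈ s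
    · rw [Set.indicator_of_mem (show x ∈ (fun x : Fin m → 𝓨 => x k) ⁻¹' s from hx)]
      simp [hx]
    · rw [Set.indicator_of_notMem (show x ∉ (fun x : Fin m → 𝓨 => x k) ⁻¹' s from hx)]
      simp [hx]
  · have : (0 : ℝ) ≤ s.indicator 1 (x k) := Set.indicator_nonneg (fun _ _ => zero_le_one) _
    dsimp only [Pi.zero_apply]
    positivity

theorem isProbabilityMeasure_dpp [IsProbabilityMeasure μ] (horth : IsONB μ φ)
    (hφ : ∀ j, Measurable (φ j)) (hm : 0 < m) : IsProbabilityMeasure (dpp μ φ) := by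
  have h := dpp_map_eval horth hφ ⟨0, hm⟩
  have hP := isProbabilityMeasure_dens (wChr_nonneg φ) (horth.integral_wChr hφ hm)
  rw [← h] at hP
  exact (Measure.isProbabilityMeasure_map_iff (measurable_pi_apply _).aemeasurable).1 hP

theorem dens_add_apply {u v : 𝓨 → ℝ} (hu : Measurable u) (hv : Measurable v)
    (hu0 : ∀ y, 0 ≤ u y) (hv0 : ∀ y, 0 ≤ v y) {a b : ℝ} (ha : 0 ≤ a) (hb : 0 ≤ b) {s : Set 𝓨}
    (hs : MeasurableSet s) :
    dens μ (fun y => a * u y + b * v y) s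
      = ENNReal.ofReal a * dens μ u s + ENNReal.ofReal b * dens μ v s := by
  simp only [dens, withDensity_apply _ hs]
  rw [← lintegral_const_mul _ hu.ennreal_ofReal, ← lintegral_const_mul _ hv.ennreal_ofReal,
    ← lintegral_add_left (hu.ennreal_ofReal.const_mul _)]
  refine lintegral_congr fun y => ?_
  rw [ENNReal.ofReal_add (mul_nonneg ha (hu0 y)) (mul_nonneg hb (hv0 y)),
    ENNReal.ofReal_mul ha, ENNReal.ofReal_mul hb]

theorem average_map_append_perm_map_eval {P : Measure (Fin m → 𝓨)} {ν ρ : Measure 𝓨}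
    [IsProbabilityMeasure P] [IsProbabilityMeasure ν]
    (hP : ∀ k, P.map (fun x => x k) = ρ) (i : Fin (m + q)) {s : Set 𝓨} (hs : MeasurableSet s) :
    (((Fintype.card (Equiv.Perm (Fin (m + q))) : ℝ≥0∞))⁻¹ •
        (∑ σ : Equiv.Perm (Fin (m + q)),
          ((P.prod (Measure.pi fun _ : Fin q => ν)).map
            (fun p => fun i : Fin (m + q) => Fin.append p.1 p.2 (σ i))))).map (fun x => x i) s
      = ((m + q : ℕ) : ℝ≥0∞)⁻¹ * (m * ρ s + q * ν s) := by
  let G : Fin (m + q) → ℝ≥0∞ := fun k =>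
    (P.prod (Measure.pi fun _ : Fin q => ν)).map (fun p => Fin.append p.1 p.2 k) s
  have hmeas : ∀ k, Measurable fun p : (Fin m → 𝓨) × (Fin q → 𝓨) => Fin.append p.1 p.2 k := by
    intro k
    induction k using Fin.addCases with
    | left j => simp only [Fin.append_left]; fun_prop
    | right j => simp only [Fin.append_right]; fun_prop
  have hleft : ∀ j, G (Fin.castAdd q j) = ρ s := by
    intro j
    have : (fun p : (Fin m → 𝓨) × (Fin q → 𝓨) => Fin.append p.1 p.2 (Fin.castAdd q j))
        = (fun x : Fin m → 𝓨 => x j) ∘ Prod.fst := by ext p; simp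
    simp only [G]
    rw [this, ← Measure.map_map (measurable_pi_apply j) measurable_fst,
      measurePreserving_fst.map_eq, hP]
  have hright : ∀ j, G (Fin.natAdd m j) = ν s := by
    intro j
    have : (fun p : (Fin m → 𝓨) × (Fin q → 𝓨) => Fin.append p.1 p.2 (Fin.natAdd m j))
        = (fun x : Fin q → 𝓨 => x j) ∘ Prod.snd := by ext p; simp
    simp only [G]
    rw [this, ← Measure.map_map (measurable_pi_apply j) measurable_snd,
      measurePreserving_snd.map_eq, (measurePreserving_eval (fun _ : Fin q => ν) j).map_eq]
  have hG : ∑ k, G k = m * ρ s + q * ν s := by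
    rw [Fin.sum_univ_add]
    simp [hleft, hright]
  have hpre : MeasurableSet ((fun x : Fin (m + q) → 𝓨 => x i) ⁻¹' s) := measurable_pi_apply i hs
  have hσ : ∀ σ : Equiv.Perm (Fin (m + q)),
      (P.prod (Measure.pi fun _ : Fin q => ν)).map
        (fun p => fun i : Fin (m + q) => Fin.append p.1 p.2 (σ i))
        ((fun x : Fin (m + q) → 𝓨 => x i) ⁻¹' s) = G (σ i) := by
    intro σ
    rw [Measure.map_apply (measurable_pi_lambda _ fun i => hmeas _) hpre,
      show G (σ i) = _ from Measure.map_apply (hmeas _) hs]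
    rfl
  have hperm := card_nsmul_sum_perm_apply G i
  simp only [Fintype.card_fin, nsmul_eq_mul] at hperm
  rw [Measure.map_apply (measurable_pi_apply i) hs, Measure.smul_apply, Measure.finsetSum_apply,
    Finset.sum_congr rfl fun σ _ => hσ σ, smul_eq_mul, Fintype.card_perm, Fintype.card_fin, ← hG]
  have hn0 : ((m + q : ℕ) : ℝ≥0∞) ≠ 0 := by
    have := i.pos
    exact_mod_cast this.ne'
  have hf0 : (((m + q).factorial : ℕ) : ℝ≥0∞) ≠ 0 := by
    exact_mod_cast (m + q).factorial_ne_zero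
  calc (((m + q).factorial : ℕ) : ℝ≥0∞)⁻¹ * ∑ σ : Equiv.Perm (Fin (m + q)), G (σ i)
      = (((m + q).factorial : ℕ) : ℝ≥0∞)⁻¹ * (((m + q : ℕ) : ℝ≥0∞)⁻¹ *
          (((m + q : ℕ) : ℝ≥0∞) * ∑ σ : Equiv.Perm (Fin (m + q)), G (σ i))) := by
        rw [← mul_assoc (((m + q : ℕ) : ℝ≥0∞)⁻¹), ENNReal.inv_mul_cancel hn0
          (ENNReal.natCast_ne_top _), one_mul]
    _ = ((m + q : ℕ) : ℝ≥0∞)⁻¹ * ((((m + q).factorial : ℕ) : ℝ≥0∞)⁻¹ *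
          (((m + q).factorial : ℕ) : ℝ≥0∞) * ∑ k, G k) := by
        rw [hperm]
        ring
    _ = _ := by
        rw [ENNReal.inv_mul_cancel hf0 (ENNReal.natCast_ne_top _), one_mul]

end Marginals

end WLSDPP

open WLSDPP in
/-- if `(x₁,…,x_n) ∼ γ_m ⊗ ν^{⊗(n−m)}` (here `n = m + q`) and an independent
uniformly random permutation `σ` is applied, then `(x_{σ(1)},…,x_{σ(n)}) ∼ γ_n^ν`
(stated as a uniform mixture over all permutations).  Consequently all marginals of
`γ_n^ν` equal `ν̃ = w̃μ` with `w̃ = (m/n) w_m + ((n−m)/n) w`, and if `w ≥ α w_m` μ-a.e.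
then `(1 − m/n) w ≤ w̃ ≤ (1 + (α⁻¹−1) m/n) w` μ-a.e. -/
theorem statement9 {𝓧 : Type*} [MeasurableSpace 𝓧] {m q : ℕ} (hm : 0 < m)
    (μ : Measure 𝓧) [IsProbabilityMeasure μ]
    (φ : Fin m → 𝓧 → ℝ) (hφ : ∀ j, Measurable (φ j)) (horth : IsONB μ φ)
    (w : 𝓧 → ℝ) (hwpos : ∀ x, 0 < w x) (hw : Measurable w) (hwint : ∫ y, w y ∂μ = 1)
    (tw : 𝓧 → ℝ)
    (htw : tw = fun a =>
      ((m : ℝ) / (m + q)) * wChr φ a + ((q : ℝ) / (m + q)) * w a) :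
    ((Fintype.card (Equiv.Perm (Fin (m + q))) : ℝ≥0∞))⁻¹ •
        (∑ σ : Equiv.Perm (Fin (m + q)),
          (((dpp μ φ).prod (Measure.pi fun _ : Fin q => dens μ w)).map
            (fun p => fun i : Fin (m + q) => Fin.append p.1 p.2 (σ i))))
      = vs μ φ w (m + q) ∧
    (∀ i : Fin (m + q), (vs μ φ w (m + q)).map (fun x => x i) = dens μ tw) ∧
    (∀ α : ℝ, 0 < α → (∀ᵐ a ∂μ, α * wChr φ a ≤ w a) →
      ∀ᵐ a ∂μ,
        (1 - (m : ℝ) / (m + q)) * w a ≤ tw a ∧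
          tw a ≤ (1 + (α⁻¹ - 1) * ((m : ℝ) / (m + q))) * w a) := by
  have hw0 : ∀ y, 0 ≤ w y := fun y => (hwpos y).le
  have hν : IsProbabilityMeasure (dens μ w) := isProbabilityMeasure_dens hw0 hwint
  have hγ : IsProbabilityMeasure (dpp μ φ) := isProbabilityMeasure_dpp horth hφ hm
  have hmix := average_map_append_perm_eq_vs (μ := μ) (q := q) hm hφ hwpos hw
  have hN : (0 : ℝ) < m + q := by positivity
  refine ⟨hmix, fun i => ?_, fun α hα hle => ?_⟩
  · ext s hs
    rw [← hmix, average_map_append_perm_map_eval (dpp_map_eval horth hφ) i hs, htw,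
      dens_add_apply (measurable_wChr hφ) hw (wChr_nonneg φ) hw0 (by positivity) (by positivity)
        hs, ENNReal.ofReal_div_of_pos hN, ENNReal.ofReal_div_of_pos hN,
      ENNReal.ofReal_natCast, ENNReal.ofReal_natCast,
      show (m : ℝ) + q = ((m + q : ℕ) : ℝ) by push_cast; rfl, ENNReal.ofReal_natCast,
      ENNReal.div_eq_inv_mul, ENNReal.div_eq_inv_mul]
    ring
  · filter_upwards [hle] with a ha
    have hq : (q : ℝ) / (m + q) = 1 - (m : ℝ) / (m + q) := by
      field_simp
      ring
    have hmn : 0 ≤ (m : ℝ) / (m + q) := by positivity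
    have hC : wChr φ a ≤ α⁻¹ * w a := by
      rw [← div_eq_inv_mul, le_div_iff₀ hα, mul_comm]
      exact ha
    simp only [htw, hq]
    constructor
    · linarith [mul_nonneg hmn (wChr_nonneg φ a)]
    · linarith [mul_le_mul_of_nonneg_left hC hmn]
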